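/- For every n ≥ 1, setting b_n = c^n_{x₀,x_{2^n}}, the conductances of E_n⁺ computed at level n satisfy: c^n_{x₀,x_j} = 2b_n for 2^{n−1} < j < 2^n; c^n_{x_j,x_{2^n}} = 2b_n for 0 < j < 2^{n−1}; c^n_{x_i,x_j} = 4b_n for 0 < i < 2^{n−1} and 2^{n−1} < j < 2^n; and b_n = 49·25^n / ((5·3^n + 16·10^n)(3^n + 6·10^n)). -/

import Mathlib

open scoped BigOperators

noncomputable section

namespace SGPaper

/-- The three corners of the Sierpinski gasket:
`q₀ = (1/2, √3/2)`, `q₁ = (0,0)`, `q₂ = (1,0)`. -/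
def q : Fin 3 → ℝ × ℝ
  | 0 => (1 / 2, Real.sqrt 3 / 2)
  | 1 => (0, 0)
  | 2 => (1, 0)

/-- The contraction map towards corner `i`: `F_i(x) = (x + q_i)/2`. -/
def Fmap (i : Fin 3) (x : ℝ × ℝ) : ℝ × ℝ := (2⁻¹ : ℝ) • (x + q i)

/-- `Fword w = F_{w₁} ∘ ⋯ ∘ F_{w_m}` for the word `w = w₁⋯w_m`. -/
def Fword (w : List (Fin 3)) : ℝ × ℝ → ℝ × ℝ :=
  w.foldr (fun i f => Fmap i ∘ f) id

/-- The level-`m` vertex set of the Sierpinski gasket: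
`V_m = ⋃_{|w| = m} F_w({q₀, q₁, q₂})`. -/
def V (m : ℕ) : Set (ℝ × ℝ) :=
  {x | ∃ w : List (Fin 3), w.length = m ∧ ∃ i : Fin 3, x = Fword w (q i)}

/-- `x` and `y` are `m`-neighbors: they are distinct and belong to a common
level-`m` cell `F_w({q₀, q₁, q₂})`. -/
def Nbr (m : ℕ) (x y : ℝ × ℝ) : Prop :=
  x ≠ y ∧ ∃ w : List (Fin 3), w.length = m ∧
    (∃ i : Fin 3, x = Fword w (q i)) ∧ (∃ j : Fin 3, y = Fword w (q j))

/-- The value `(u x - u y)²` on the unordered pair `{x, y}`. -/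
def edgeVal (u : ℝ × ℝ → ℝ) : Sym2 (ℝ × ℝ) → ℝ :=
  Sym2.lift ⟨fun x y => (u x - u y) ^ 2, fun _ _ => by ring⟩

/-- The unordered pair `e` is an edge of the level-`m` graph `Γ_m`. -/
def IsEdge (m : ℕ) (e : Sym2 (ℝ × ℝ)) : Prop :=
  ∃ x y : ℝ × ℝ, Nbr m x y ∧ e = s(x, y)

/-- The level-`m` graph energy: `E_m(u) = (5/3)^m Σ (u x − u y)²`, the sum being over
unordered `m`-neighbor pairs `{x, y}` (a finite set, so `tsum` is the honest sum). -/
def Energy (m : ℕ) (u : ℝ × ℝ → ℝ) : ℝ :=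
  (5 / 3 : ℝ) ^ m * ∑' e : {e : Sym2 (ℝ × ℝ) // IsEdge m e}, edgeVal u e

/-- `Q_E(v)`: minimal level-`m` energy among functions `u : V_m → ℝ` agreeing
with `v` on `E` (the minimum is attained, so it equals this infimum). -/
def Q (m : ℕ) (E : Set (ℝ × ℝ)) (v : ℝ × ℝ → ℝ) : ℝ :=
  sInf {r | ∃ u : ℝ × ℝ → ℝ, (∀ x ∈ E, u x = v x) ∧ r = Energy m u}

/-- Indicator function of the point `z`. -/
def ind (z : ℝ × ℝ) : ℝ × ℝ → ℝ := fun t => if t = z then 1 else 0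

/-- The conductance `c^E_{x,y} = (Q_E(𝟙_x) + Q_E(𝟙_y) − Q_E(𝟙_x + 𝟙_y))/2`
between `x, y ∈ E`, computed at level `m`. -/
def cond (m : ℕ) (E : Set (ℝ × ℝ)) (x y : ℝ × ℝ) : ℝ :=
  (Q m E (ind x) + Q m E (ind y) - Q m E (ind x + ind y)) / 2

/-- The `j`-th bottom-row point of `V_n`: `x_j = q₁ + (j/2ⁿ)(q₂ − q₁)`. -/
def xb (n j : ℕ) : ℝ × ℝ := q 1 + ((j : ℝ) / 2 ^ n) • (q 2 - q 1)

/-- The bottom row `Ẽ_n = {x₀, …, x_{2ⁿ}}` of `V_n`. -/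
def Ebot (n : ℕ) : Set (ℝ × ℝ) := {p | ∃ j ≤ 2 ^ n, p = xb n j}

/-- The bottom row together with the top point: `E_n⁺ = {q₀, x₀, …, x_{2ⁿ}}`. -/
def Eplus (n : ℕ) : Set (ℝ × ℝ) := insert (q 0) (Ebot n)

/-- Barycentric coordinates. -/
def lam : Fin 3 → ℝ × ℝ → ℝ
  | 0, z => 2 * z.2 / Real.sqrt 3
  | 1, z => 1 - z.1 - z.2 / Real.sqrt 3
  | 2, z => z.1 - z.2 / Real.sqrt 3

lemma sqrt3_ne : Real.sqrt 3 ≠ 0 := by positivity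

lemma lam_sum (z : ℝ × ℝ) : lam 0 z + lam 1 z + lam 2 z = 1 := by
  simp only [lam]; ring

lemma lam_q (i j : Fin 3) : lam i (q j) = if i = j then 1 else 0 := by
  have := sqrt3_ne
  fin_cases i <;> fin_cases j <;> simp [lam, q] <;> field_simp <;> norm_num

lemma lam_F (i j : Fin 3) (z : ℝ × ℝ) :
    lam i (Fmap j z) = (lam i z + if i = j then 1 else 0) / 2 := by
  rw [← lam_q i j]
  fin_cases i <;> simp [lam, Fmap] <;> ring

lemma lam_inj {x y : ℝ × ℝ} (h : ∀ i, lam i x = lam i y) : x = y := by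
  have h0 := h 0
  have h2 := h 2
  simp only [lam] at h0 h2
  have h3 := sqrt3_ne
  have e2 : x.2 = y.2 := by
    field_simp at h0
    linarith
  have e1 : x.1 = y.1 := by
    rw [e2] at h2
    linarith
  exact Prod.ext e1 e2

/-- The closed triangle. -/
def Tri : Set (ℝ × ℝ) := {z | ∀ i, 0 ≤ lam i z}

lemma q_mem (i : Fin 3) : q i ∈ Tri := by
  intro j
  rw [lam_q]
  split_ifs <;> norm_num

lemma F_mem (i : Fin 3) {z : ℝ × ℝ} (hz : z ∈ Tri) : Fmap i z ∈ Tri := by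
  intro j
  rw [lam_F]
  have := hz j
  split_ifs <;> linarith

lemma F_inj (i : Fin 3) : Function.Injective (Fmap i) := by
  intro x y h
  apply lam_inj
  intro j
  have := congrArg (lam j) h
  rw [lam_F, lam_F] at this
  linarith

lemma eq_q_of {z : ℝ × ℝ} (hz : z ∈ Tri) (i : Fin 3) (h : 1 ≤ lam i z) : z = q i := by
  apply lam_inj
  have h0 := hz 0
  have h1 := hz 1
  have h2 := hz 2
  have hs := lam_sum z
  intro j
  rw [lam_q]
  fin_cases i <;> fin_cases j <;> simp at * <;> linarith

lemma F_overlap {i j : Fin 3} (hij : i ≠ j) {x y : ℝ × ℝ} (hx : x ∈ Tri) (hy : y ∈ Tri)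
    (h : Fmap i x = Fmap j y) : x = q j := by
  apply eq_q_of hx
  have := congrArg (lam j) h
  rw [lam_F, lam_F, if_neg hij.symm, if_pos rfl] at this
  have := hy j
  linarith

lemma F_comm (i j : Fin 3) : Fmap i (q j) = Fmap j (q i) := by
  simp [Fmap, add_comm]

lemma Fword_mem (w : List (Fin 3)) {z : ℝ × ℝ} (hz : z ∈ Tri) : Fword w z ∈ Tri := by
  induction w with
  | nil => simpa [Fword] using hz
  | cons i w ih => exact F_mem i ih

lemma Fword_cons (i : Fin 3) (w : List (Fin 3)) (z : ℝ × ℝ) :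
    Fword (i :: w) z = Fmap i (Fword w z) := rfl

lemma edge_repr {m : ℕ} {e : Sym2 (ℝ × ℝ)} (h : IsEdge m e) :
    ∃ x y, x ∈ Tri ∧ y ∈ Tri ∧ x ≠ y ∧ e = s(x, y) := by
  obtain ⟨x, y, ⟨hne, w, -, ⟨i, hi⟩, ⟨j, hj⟩⟩, rfl⟩ := h
  exact ⟨x, y, hi ▸ Fword_mem w (q_mem i), hj ▸ Fword_mem w (q_mem j), hne, rfl⟩

lemma edge_map {m : ℕ} {e : Sym2 (ℝ × ℝ)} (i : Fin 3) (h : IsEdge m e) :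
    IsEdge (m + 1) (e.map (Fmap i)) := by
  obtain ⟨x, y, ⟨hne, w, hw, ⟨k, hk⟩, ⟨j, hj⟩⟩, rfl⟩ := h
  refine ⟨Fmap i x, Fmap i y, ⟨fun h => hne (F_inj i h), i :: w, by simp [hw], ⟨k, ?_⟩, ⟨j, ?_⟩⟩, rfl⟩
  · rw [Fword_cons, hk]
  · rw [Fword_cons, hj]

def edgeFun (m : ℕ) (p : Fin 3 × {e : Sym2 (ℝ × ℝ) // IsEdge m e}) :
    {e : Sym2 (ℝ × ℝ) // IsEdge (m + 1) e} :=
  ⟨p.2.1.map (Fmap p.1), edge_map p.1 p.2.2⟩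

lemma edgeFun_bij (m : ℕ) : Function.Bijective (edgeFun m) := by
  constructor
  · rintro ⟨i, e, he⟩ ⟨j, e', he'⟩ h
    have h : e.map (Fmap i) = e'.map (Fmap j) := congrArg Subtype.val h
    by_cases hij : i = j
    · subst hij
      have := Sym2.map.injective (F_inj i) h
      subst this
      rfl
    · exfalso
      obtain ⟨x, y, hx, hy, hne, rfl⟩ := edge_repr he
      obtain ⟨x', y', hx', hy', hne', rfl⟩ := edge_repr he'
      simp only [Sym2.map_mk, Sym2.eq_iff] at h
      rcases h with ⟨h1, h2⟩ | ⟨h1, h2⟩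
      · exact hne ((F_overlap hij hx hx' h1).trans (F_overlap hij hy hy' h2).symm)
      · exact hne ((F_overlap hij hx hy' h1).trans (F_overlap hij hy hx' h2).symm)
  · rintro ⟨e, x, y, ⟨hne, w, hw, ⟨k, hk⟩, ⟨j, hj⟩⟩, rfl⟩
    cases w with
    | nil => simp at hw
    | cons i w =>
      rw [Fword_cons] at hk hj
      refine ⟨(i, ⟨s(Fword w (q k), Fword w (q j)), _, _, ⟨?_, w, by simpa using hw, ⟨k, rfl⟩, ⟨j, rfl⟩⟩, rfl⟩), ?_⟩
      · intro h
        apply hne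
        rw [hk, hj, h]
      · apply Subtype.ext
        simp [edgeFun, hk, hj]

lemma q_inj {i j : Fin 3} (h : q i = q j) : i = j := by
  have := congrArg (lam i) h
  rw [lam_q, lam_q] at this
  by_contra hne
  simp [hne] at this

def edgeFun0 (i : Fin 3) : {e : Sym2 (ℝ × ℝ) // IsEdge 0 e} :=
  ⟨s(q i, q (i + 1)), _, _, ⟨fun h => by
    have := q_inj h
    revert this
    fin_cases i <;> decide, [], rfl, ⟨i, rfl⟩, ⟨i + 1, rfl⟩⟩, rfl⟩

lemma edgeFun0_bij : Function.Bijective edgeFun0 := by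
  constructor
  · intro i j h
    have h : s(q i, q (i + 1)) = s(q j, q (j + 1)) := congrArg Subtype.val h
    rw [Sym2.eq_iff] at h
    rcases h with ⟨h, -⟩ | ⟨h1, h2⟩
    · exact q_inj h
    · have h1 := q_inj h1
      have h2 := q_inj h2
      revert h1 h2
      fin_cases i <;> fin_cases j <;> decide
  · rintro ⟨e, x, y, ⟨hne, w, hw, ⟨k, hk⟩, ⟨j, hj⟩⟩, rfl⟩
    obtain rfl := List.length_eq_zero_iff.1 hw
    simp only [Fword, List.foldr_nil, id] at hk hj
    subst hk hj
    have hkj : k ≠ j := fun h => hne (by rw [h])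
    have : j = k + 1 ∨ k = j + 1 := by
      clear hne hw
      revert k j
      decide
    rcases this with rfl | rfl
    · exact ⟨k, rfl⟩
    · exact ⟨j, Subtype.ext Sym2.eq_swap⟩

lemma edge_finite (m : ℕ) : Finite {e : Sym2 (ℝ × ℝ) // IsEdge m e} := by
  induction m with
  | zero => exact Finite.of_surjective _ edgeFun0_bij.2
  | succ m ih => exact Finite.of_surjective _ (edgeFun_bij m).2

lemma edgeVal_map (u : ℝ × ℝ → ℝ) (f : ℝ × ℝ → ℝ × ℝ) (e : Sym2 (ℝ × ℝ)) :
    edgeVal u (e.map f) = edgeVal (u ∘ f) e := by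
  induction e with
  | h x y => rfl

lemma Energy_zero (u : ℝ × ℝ → ℝ) :
    Energy 0 u = (u (q 0) - u (q 1)) ^ 2 + (u (q 1) - u (q 2)) ^ 2 + (u (q 2) - u (q 0)) ^ 2 := by
  unfold Energy
  rw [← (Equiv.ofBijective _ edgeFun0_bij).tsum_eq, tsum_fintype, Fin.sum_univ_three]
  simp only [pow_zero, one_mul]
  rfl

lemma Energy_succ (m : ℕ) (u : ℝ × ℝ → ℝ) :
    Energy (m + 1) u = 5 / 3 * (Energy m (u ∘ Fmap 0) + Energy m (u ∘ Fmap 1)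
      + Energy m (u ∘ Fmap 2)) := by
  have := edge_finite m
  have := Fintype.ofFinite {e : Sym2 (ℝ × ℝ) // IsEdge m e}
  unfold Energy
  rw [← (Equiv.ofBijective _ (edgeFun_bij m)).tsum_eq, tsum_fintype, Fintype.sum_prod_type,
    Fin.sum_univ_three]
  simp only [tsum_fintype, Equiv.ofBijective_apply, edgeFun, edgeVal_map]
  ring

lemma Energy_congr (m : ℕ) {u v : ℝ × ℝ → ℝ} (h : ∀ z ∈ Tri, u z = v z) :
    Energy m u = Energy m v := by
  unfold Energy
  congr 1
  apply tsum_congr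
  rintro ⟨e, he⟩
  obtain ⟨x, y, hx, hy, -, rfl⟩ := edge_repr he
  simp [edgeVal, h x hx, h y hy]

lemma F_inv (i : Fin 3) (z : ℝ × ℝ) : (2 : ℝ) • Fmap i z - q i = z := by
  simp [Fmap, smul_smul]

lemma glue (u0 u1 u2 : ℝ × ℝ → ℝ) (h01 : u0 (q 1) = u1 (q 0)) (h02 : u0 (q 2) = u2 (q 0))
    (h12 : u1 (q 2) = u2 (q 1)) :
    ∃ u : ℝ × ℝ → ℝ, (∀ z ∈ Tri, u (Fmap 0 z) = u0 z) ∧ (∀ z ∈ Tri, u (Fmap 1 z) = u1 z) ∧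
      (∀ z ∈ Tri, u (Fmap 2 z) = u2 z) := by
  classical
  refine ⟨fun z => if 1 / 2 ≤ lam 0 z then u0 ((2 : ℝ) • z - q 0) else
    if 1 / 2 ≤ lam 1 z then u1 ((2 : ℝ) • z - q 1) else u2 ((2 : ℝ) • z - q 2), ?_, ?_, ?_⟩
  · intro z hz
    have := hz 0
    have h : 1 / 2 ≤ lam 0 (Fmap 0 z) := by
      rw [lam_F, if_pos rfl]
      linarith
    simp only [if_pos h, F_inv]
  · intro z hz
    have := hz 1
    have h : 1 / 2 ≤ lam 1 (Fmap 1 z) := by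
      rw [lam_F, if_pos rfl]
      linarith
    simp only [if_pos h, F_inv]
    split_ifs with h0
    · rw [lam_F, if_neg (by decide)] at h0
      have e := eq_q_of hz 0 (by linarith)
      rw [e, F_comm, F_inv, h01]
    · rfl
  · intro z hz
    simp only [F_inv]
    split_ifs with h0 h1
    · rw [lam_F, if_neg (by decide)] at h0
      have e := eq_q_of hz 0 (by linarith)
      rw [e, F_comm, F_inv, h02]
    · rw [lam_F, if_neg (by decide)] at h1
      have e := eq_q_of hz 1 (by linarith)
      rw [e, F_comm, F_inv, h12]
    · rfl

lemma F_self (i : Fin 3) : Fmap i (q i) = q i := by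
  simp only [Fmap, ← two_smul ℝ (q i), smul_smul]
  norm_num

/-- Harmonic renormalization. -/
lemma tri_lower (m : ℕ) (u : ℝ × ℝ → ℝ) :
    (u (q 0) - u (q 1)) ^ 2 + (u (q 1) - u (q 2)) ^ 2 + (u (q 2) - u (q 0)) ^ 2 ≤ Energy m u := by
  induction m generalizing u with
  | zero => rw [Energy_zero]
  | succ m ih =>
    rw [Energy_succ]
    have h0 := ih (u ∘ Fmap 0)
    have h1 := ih (u ∘ Fmap 1)
    have h2 := ih (u ∘ Fmap 2)
    simp only [Function.comp_apply, F_self, F_comm 1 0, F_comm 2 0, F_comm 2 1] at h0 h1 h2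
    generalize u (q 0) = a at *
    generalize u (q 1) = b at *
    generalize u (q 2) = c at *
    generalize u (Fmap 0 (q 1)) = p at *
    generalize u (Fmap 0 (q 2)) = r at *
    generalize u (Fmap 1 (q 2)) = s at *
    nlinarith [sq_nonneg (5 * p - (2 * a + 2 * b + c) ), sq_nonneg (5 * r - (2 * a + 2 * c + b)),
      sq_nonneg (5 * s - (2 * b + 2 * c + a)),
      sq_nonneg (5 * p - (2 * a + 2 * b + c) - (5 * r - (2 * a + 2 * c + b))),
      sq_nonneg (5 * p - (2 * a + 2 * b + c) - (5 * s - (2 * b + 2 * c + a))),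
      sq_nonneg (5 * r - (2 * a + 2 * c + b) - (5 * s - (2 * b + 2 * c + a)))]

lemma tri_attain (m : ℕ) (a b c : ℝ) : ∃ u : ℝ × ℝ → ℝ, u (q 0) = a ∧ u (q 1) = b ∧ u (q 2) = c ∧
    Energy m u = (a - b) ^ 2 + (b - c) ^ 2 + (c - a) ^ 2 := by
  induction m generalizing a b c with
  | zero =>
    refine ⟨fun z => a * lam 0 z + b * lam 1 z + c * lam 2 z, ?_⟩
    rw [Energy_zero]
    simp [lam_q]
  | succ m ih =>
    obtain ⟨u0, ha0, hb0, hc0, he0⟩ := ih a ((2 * a + 2 * b + c) / 5) ((2 * a + 2 * c + b) / 5)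
    obtain ⟨u1, ha1, hb1, hc1, he1⟩ := ih ((2 * a + 2 * b + c) / 5) b ((2 * b + 2 * c + a) / 5)
    obtain ⟨u2, ha2, hb2, hc2, he2⟩ := ih ((2 * a + 2 * c + b) / 5) ((2 * b + 2 * c + a) / 5) c
    obtain ⟨u, h0, h1, h2⟩ := glue u0 u1 u2 (by rw [hb0, ha1]) (by rw [hc0, ha2]) (by rw [hc1, hb2])
    refine ⟨u, ?_, ?_, ?_, ?_⟩
    · rw [← F_self 0, h0 _ (q_mem 0), ha0]
    · rw [← F_self 1, h1 _ (q_mem 1), hb1]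
    · rw [← F_self 2, h2 _ (q_mem 2), hc2]
    · rw [Energy_succ, Energy_congr m (u := u ∘ Fmap 0) (v := u0) h0,
        Energy_congr m (u := u ∘ Fmap 1) (v := u1) h1,
        Energy_congr m (u := u ∘ Fmap 2) (v := u2) h2, he0, he1, he2]
      ring

def tt : ℕ → ℝ
  | 0 => 1
  | n + 1 => 5 / 3 * tt n / (1 + 2 ^ (n + 1) * tt n)

def ss (n : ℕ) : ℝ := 2 ^ (n + 1) * tt n

lemma tt_pos (n : ℕ) : 0 < tt n := by
  induction n with
  | zero => simp [tt]
  | succ n ih => rw [tt]; positivity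

lemma ss_pos (n : ℕ) : 0 < ss n := by
  have := tt_pos n
  unfold ss; positivity

lemma ss_succ (n : ℕ) : ss (n + 1) = 10 / 3 * ss n / (1 + ss n) := by
  simp only [ss, tt]
  ring

def WW (n : ℕ) (v : ℕ → ℝ) : ℝ := ∑ j ∈ Finset.range (2 ^ n), (v j + v (j + 1))

lemma WW_succ (n : ℕ) (v : ℕ → ℝ) : WW (n + 1) v = WW n v + WW n (fun j => v (2 ^ n + j)) := by
  unfold WW
  rw [pow_succ, mul_two, Finset.sum_range_add]
  rfl

def LL (n : ℕ) (v : ℕ → ℝ) : ℝ := tt n * WW n v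

lemma LL_succ (n : ℕ) (v : ℕ → ℝ) :
    LL (n + 1) v = 5 / 3 * (LL n v + LL n (fun j => v (2 ^ n + j))) / (1 + ss n) := by
  simp only [LL, WW_succ, tt, ss]
  ring

def RR : ℕ → (ℕ → ℝ) → ℝ
  | 0, v => v 0 ^ 2 + v 1 ^ 2 + (v 0 - v 1) ^ 2
  | n + 1, v => 5 / 3 * (RR n v + RR n (fun j => v (2 ^ n + j)) -
      ((2 + ss n) * (LL n v ^ 2 + LL n (fun j => v (2 ^ n + j)) ^ 2)
        + 2 * LL n v * LL n (fun j => v (2 ^ n + j))) / ((1 + ss n) * (3 + ss n)))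

def MM (n : ℕ) (a : ℝ) (v : ℕ → ℝ) : ℝ := ss n * a ^ 2 - 2 * a * LL n v + RR n v

/-- Completing the square for the two eliminated vertices. -/
lemma MM_succ (n : ℕ) (a p r : ℝ) (v : ℕ → ℝ) :
    5 / 3 * ((a - p) ^ 2 + (p - r) ^ 2 + (r - a) ^ 2 + MM n p v + MM n r (fun j => v (2 ^ n + j)))
    = MM (n + 1) a v + 5 / 3 * (
      (1 + ss n) / 2 * (p + r - (2 * a + LL n v + LL n (fun j => v (2 ^ n + j))) / (1 + ss n)) ^ 2 +
      (3 + ss n) / 2 * (p - r - (LL n v - LL n (fun j => v (2 ^ n + j))) / (3 + ss n)) ^ 2) := by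
  have h := ss_pos n
  have h1 : 1 + ss n ≠ 0 := by positivity
  have h3 : 3 + ss n ≠ 0 := by positivity
  simp only [MM, RR, LL_succ, ss_succ]
  generalize ss n = s at *
  generalize LL n v = l
  generalize LL n (fun j => v (2 ^ n + j)) = l'
  field_simp
  ring

lemma F1_xb (n j : ℕ) : Fmap 1 (xb n j) = xb (n + 1) j := by
  simp only [Fmap, xb, q, pow_succ]
  ext <;> simp
  ring

lemma F2_xb (n j : ℕ) : Fmap 2 (xb n j) = xb (n + 1) (2 ^ n + j) := by
  simp only [Fmap, xb, q, pow_succ]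
  ext <;> simp
  field_simp
  ring

lemma xb_zero (n : ℕ) : xb n 0 = q 1 := by simp [xb]

lemma xb_last (n : ℕ) : xb n (2 ^ n) = q 2 := by simp [xb, q]

lemma xb_mem (n j : ℕ) (h : j ≤ 2 ^ n) : xb n j ∈ Tri := by
  have h' : (j : ℝ) / 2 ^ n ≤ 1 := by
    rw [div_le_one (by positivity)]
    exact_mod_cast h
  intro i
  fin_cases i <;> simp [lam, xb, q, h'] ; positivity

lemma main_lower (n : ℕ) (u : ℝ × ℝ → ℝ) : MM n (u (q 0)) (fun j => u (xb n j)) ≤ Energy n u := by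
  induction n generalizing u with
  | zero =>
    rw [Energy_zero]
    have h0 := xb_zero 0
    have h1 := xb_last 0
    simp only [pow_zero] at h1
    simp [MM, RR, LL, WW, ss, tt, h0, h1]
    linarith
  | succ n ih =>
    rw [Energy_succ]
    have h0 := tri_lower n (u ∘ Fmap 0)
    have h1 := ih (u ∘ Fmap 1)
    have h2 := ih (u ∘ Fmap 2)
    simp only [Function.comp_apply, F_self, F_comm 1 0, F_comm 2 0, F1_xb, F2_xb] at h0 h1 h2
    have h3 := MM_succ n (u (q 0)) (u (Fmap 0 (q 1))) (u (Fmap 0 (q 2))) (fun j => u (xb (n + 1) j))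
    have h := ss_pos n
    have h4 : 0 ≤ 5 / 3 * (
      (1 + ss n) / 2 * (u (Fmap 0 (q 1)) + u (Fmap 0 (q 2)) - (2 * u (q 0) + LL n (fun j => u (xb (n + 1) j)) + LL n (fun j => u (xb (n + 1) (2 ^ n + j)))) / (1 + ss n)) ^ 2 +
      (3 + ss n) / 2 * (u (Fmap 0 (q 1)) - u (Fmap 0 (q 2)) - (LL n (fun j => u (xb (n + 1) j)) - LL n (fun j => u (xb (n + 1) (2 ^ n + j)))) / (3 + ss n)) ^ 2) := by
      positivity
    linarith

lemma main_attain (n : ℕ) (a : ℝ) (v : ℕ → ℝ) : ∃ u : ℝ × ℝ → ℝ, u (q 0) = a ∧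
    (∀ j ≤ 2 ^ n, u (xb n j) = v j) ∧ Energy n u = MM n a v := by
  induction n generalizing a v with
  | zero =>
    obtain ⟨u, ha, hb, hc, he⟩ := tri_attain 0 a (v 0) (v 1)
    have h0 := xb_zero 0
    have h1 := xb_last 0
    simp only [pow_zero] at h1
    refine ⟨u, ha, ?_, ?_⟩
    · intro j hj
      simp only [pow_zero] at hj
      interval_cases j
      · rw [h0, hb]
      · rw [h1, hc]
    · rw [he]
      simp [MM, RR, LL, WW, ss, tt]
      ring
  | succ n ih =>
    have hs := ss_pos n
    obtain ⟨A, hA⟩ : ∃ A, A = (2 * a + LL n v + LL n (fun j => v (2 ^ n + j))) / (1 + ss n) := ⟨_, rfl⟩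
    obtain ⟨B, hB⟩ : ∃ B, B = (LL n v - LL n (fun j => v (2 ^ n + j))) / (3 + ss n) := ⟨_, rfl⟩
    obtain ⟨u0, ha0, hb0, hc0, he0⟩ := tri_attain n a ((A + B) / 2) ((A - B) / 2)
    obtain ⟨u1, ha1, hb1, he1⟩ := ih ((A + B) / 2) v
    obtain ⟨u2, ha2, hb2, he2⟩ := ih ((A - B) / 2) (fun j => v (2 ^ n + j))
    obtain ⟨u, h0, h1, h2⟩ := glue u0 u1 u2 (by rw [hb0, ha1]) (by rw [hc0, ha2])
      (by rw [← xb_last n, ← xb_zero n, hb1 _ le_rfl, hb2 _ (Nat.zero_le _), add_zero])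
    refine ⟨u, ?_, ?_, ?_⟩
    · rw [← F_self 0, h0 _ (q_mem 0), ha0]
    · intro j hj
      rcases le_total j (2 ^ n) with h | h
      · rw [← F1_xb, h1 _ (xb_mem n j h), hb1 j h]
      · obtain ⟨k, rfl⟩ := Nat.exists_eq_add_of_le h
        have hk : k ≤ 2 ^ n := by
          rw [pow_succ] at hj
          omega
        rw [← F2_xb, h2 _ (xb_mem n k hk), hb2 k hk]
    · rw [Energy_succ, Energy_congr n (u := u ∘ Fmap 0) (v := u0) h0,
        Energy_congr n (u := u ∘ Fmap 1) (v := u1) h1,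
        Energy_congr n (u := u ∘ Fmap 2) (v := u2) h2, he0, he1, he2]
      have := MM_succ n a ((A + B) / 2) ((A - B) / 2) v
      rw [← hA, ← hB] at this
      linear_combination this

lemma WW_congr (n : ℕ) {v w : ℕ → ℝ} (h : ∀ j ≤ 2 ^ n, v j = w j) : WW n v = WW n w := by
  unfold WW
  apply Finset.sum_congr rfl
  intro j hj
  rw [Finset.mem_range] at hj
  rw [h j (by omega), h (j + 1) (by omega)]

lemma LL_congr (n : ℕ) {v w : ℕ → ℝ} (h : ∀ j ≤ 2 ^ n, v j = w j) : LL n v = LL n w := by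
  rw [LL, LL, WW_congr n h]

lemma RR_congr (n : ℕ) {v w : ℕ → ℝ} (h : ∀ j ≤ 2 ^ n, v j = w j) : RR n v = RR n w := by
  induction n generalizing v w with
  | zero => simp [RR, h 0 (by simp), h 1 (by simp)]
  | succ n ih =>
    have e : 2 ^ (n + 1) = 2 ^ n + 2 ^ n := by ring
    have h1 : ∀ j ≤ 2 ^ n, v j = w j := fun j hj => h j (by omega)
    have h2 : ∀ j ≤ 2 ^ n, v (2 ^ n + j) = w (2 ^ n + j) := fun j hj => h _ (by omega)
    rw [RR, RR, ih h1, ih h2, LL_congr n h1, LL_congr n h2]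

lemma RR_zero (n : ℕ) : RR n (fun _ => 0) = 0 := by
  induction n with
  | zero => simp [RR]
  | succ n ih => simp [RR, ih, LL, WW]

lemma MM_congr (n : ℕ) (a : ℝ) {v w : ℕ → ℝ} (h : ∀ j ≤ 2 ^ n, v j = w j) :
    MM n a v = MM n a w := by
  rw [MM, MM, RR_congr n h, LL_congr n h]

lemma Q_eq (n : ℕ) (v : ℝ × ℝ → ℝ) :
    Q n (Eplus n) v = MM n (v (q 0)) (fun j => v (xb n j)) := by
  apply IsLeast.csInf_eq
  constructor
  · obtain ⟨u, h0, h1, h2⟩ := main_attain n (v (q 0)) (fun j => v (xb n j))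
    refine ⟨u, ?_, h2.symm⟩
    rintro x (rfl | ⟨j, hj, rfl⟩)
    · exact h0
    · exact h1 j hj
  · rintro r ⟨u, hu, rfl⟩
    have h := main_lower n u
    rw [hu _ (Or.inl rfl), MM_congr n _ (fun j hj => hu _ (Or.inr ⟨j, hj, rfl⟩))] at h
    exact h

lemma ind_q (n j : ℕ) : ind (xb n j) (q 0) = 0 := by
  unfold ind
  rw [if_neg]
  intro h
  have := congrArg Prod.snd h
  simp [xb, q] at this

lemma ind_xb (n i j : ℕ) : ind (xb n i) (xb n j) = if j = i then 1 else 0 := by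
  unfold ind
  congr 1
  apply propext
  constructor
  · intro h
    have := congrArg Prod.fst h
    simpa [xb, q, div_left_inj'] using this
  · rintro rfl
    rfl

def dl (i : ℕ) : ℕ → ℝ := fun j => if j = i then 1 else 0

lemma cond_eq (n i j : ℕ) : cond n (Eplus n) (xb n i) (xb n j) =
    (RR n (dl i) + RR n (dl j) - RR n (fun k => dl i k + dl j k)) / 2 := by
  unfold cond
  simp only [Q_eq, MM, Pi.add_apply, ind_q, ind_xb]
  simp only [dl, mul_zero, zero_mul, ne_eq, OfNat.ofNat_ne_zero, not_false_eq_true, zero_pow,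
    add_zero, sub_zero, zero_add]
  rfl

lemma cond_succ (n i k : ℕ) (hi : i < 2 ^ n) (hk : 0 < k) :
    cond (n + 1) (Eplus (n + 1)) (xb (n + 1) i) (xb (n + 1) (2 ^ n + k)) =
    5 / 3 * (LL n (dl i) * LL n (dl k)) / ((1 + ss n) * (3 + ss n)) := by
  have a1 : ∀ j ≤ 2 ^ n, dl (2 ^ n + k) j = 0 := by
    intro j hj
    rw [dl, if_neg (by omega)]
  have a2 : ∀ j ≤ 2 ^ n, dl i (2 ^ n + j) = 0 := by
    intro j hj
    rw [dl, if_neg (by omega)]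
  have a3 : ∀ j ≤ 2 ^ n, dl (2 ^ n + k) (2 ^ n + j) = dl k j := by
    intro j hj
    simp [dl]
  have a4 : ∀ j ≤ 2 ^ n, dl i j + dl (2 ^ n + k) j = dl i j := by
    intro j hj
    rw [a1 j hj, add_zero]
  have a5 : ∀ j ≤ 2 ^ n, dl i (2 ^ n + j) + dl (2 ^ n + k) (2 ^ n + j) = dl k j := by
    intro j hj
    rw [a2 j hj, a3 j hj, zero_add]
  have hL0 : LL n (fun _ => 0) = 0 := by simp [LL, WW]
  rw [cond_eq, RR, RR, RR, RR_congr n a1, RR_congr n a2, RR_congr n a3, RR_congr n a4,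
    RR_congr n a5, LL_congr n a1, LL_congr n a2, LL_congr n a3, LL_congr n a4,
    LL_congr n a5, RR_zero, hL0]
  ring

lemma WW_dl (n i : ℕ) : WW n (dl i) =
    (if i < 2 ^ n then 1 else 0) + (if 0 < i ∧ i ≤ 2 ^ n then 1 else 0) := by
  unfold WW dl
  rw [Finset.sum_add_distrib]
  congr 1
  · rw [Finset.sum_ite_eq']
    simp
  · cases i with
    | zero => simp
    | succ i => simp [Nat.succ_le_iff]

lemma LL_zero (n : ℕ) : LL n (dl 0) = tt n := by simp [LL, WW_dl]
lemma LL_last (n : ℕ) : LL n (dl (2 ^ n)) = tt n := by simp [LL, WW_dl]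
lemma LL_mid (n i : ℕ) (h0 : 0 < i) (h1 : i < 2 ^ n) : LL n (dl i) = 2 * tt n := by
  rw [LL, WW_dl, if_pos h1, if_pos ⟨h0, h1.le⟩]
  ring

lemma tt_eq (n : ℕ) : tt n = 7 * 5 ^ n / (3 ^ n + 6 * 10 ^ n) := by
  induction n with
  | zero => norm_num [tt]
  | succ n ih =>
    rw [tt, ih]
    have e : (10 : ℝ) ^ n = 2 ^ n * 5 ^ n := by rw [← mul_pow]; norm_num
    rw [pow_succ 10, e, pow_succ 2, pow_succ 5, pow_succ 3]
    have h2 : (0 : ℝ) < 2 ^ n := by positivity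
    have h3 : (0 : ℝ) < 3 ^ n := by positivity
    have h5 : (0 : ℝ) < 5 ^ n := by positivity
    generalize (2 : ℝ) ^ n = x at *
    generalize (3 : ℝ) ^ n = y at *
    generalize (5 : ℝ) ^ n = z at *
    have : y + 6 * (x * z) + x * 2 * (7 * z) ≠ 0 := by positivity
    field_simp
    ring

lemma b_eq (n : ℕ) : 5 / 3 * (tt n * tt n) / ((1 + ss n) * (3 + ss n)) =
    49 * 25 ^ (n + 1) / ((5 * 3 ^ (n + 1) + 16 * 10 ^ (n + 1)) * (3 ^ (n + 1) + 6 * 10 ^ (n + 1))) := by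
  rw [ss, tt_eq]
  have e : (10 : ℝ) ^ n = 2 ^ n * 5 ^ n := by rw [← mul_pow]; norm_num
  have e' : (25 : ℝ) ^ n = 5 ^ n * 5 ^ n := by rw [← mul_pow]; norm_num
  rw [pow_succ 10, pow_succ 25, e, e', pow_succ 2, pow_succ 3]
  have h2 : (0 : ℝ) < 2 ^ n := by positivity
  have h3 : (0 : ℝ) < 3 ^ n := by positivity
  have h5 : (0 : ℝ) < 5 ^ n := by positivity
  generalize (2 : ℝ) ^ n = x at *
  generalize (3 : ℝ) ^ n = y at *
  generalize (5 : ℝ) ^ n = z at *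
  have hd : 0 < y + 6 * (x * z) := by positivity
  have e1 : 1 + x * 2 * (7 * z / (y + 6 * (x * z))) = (y + 20 * (x * z)) / (y + 6 * (x * z)) := by
    field_simp
    ring
  have e3 : 3 + x * 2 * (7 * z / (y + 6 * (x * z))) = (3 * y + 32 * (x * z)) / (y + 6 * (x * z)) := by
    field_simp
    ring
  rw [e1, e3]
  have f1 : y * 3 + 6 * (x * z * 10) = 3 * (y + 20 * (x * z)) := by ring
  have f2 : 5 * (y * 3) + 16 * (x * z * 10) = 5 * (3 * y + 32 * (x * z)) := by ring
  rw [f1, f2]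
  have : 0 < y + 20 * (x * z) := by positivity
  have : 0 < 3 * y + 32 * (x * z) := by positivity
  field_simp
  ring

/-- Conductances of `E_n⁺` at level `n` between the two halves of the
bottom row, with `b_n = c^n_{x₀, x_{2ⁿ}} = 49·25ⁿ/((5·3ⁿ + 16·10ⁿ)(3ⁿ + 6·10ⁿ))`. -/
theorem stmt11 (n : ℕ) (hn : 1 ≤ n) :
    (∀ j : ℕ, 2 ^ (n - 1) < j → j < 2 ^ n →
      cond n (Eplus n) (xb n 0) (xb n j) =
        2 * cond n (Eplus n) (xb n 0) (xb n (2 ^ n))) ∧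
    (∀ j : ℕ, 0 < j → j < 2 ^ (n - 1) →
      cond n (Eplus n) (xb n j) (xb n (2 ^ n)) =
        2 * cond n (Eplus n) (xb n 0) (xb n (2 ^ n))) ∧
    (∀ i j : ℕ, 0 < i → i < 2 ^ (n - 1) → 2 ^ (n - 1) < j → j < 2 ^ n →
      cond n (Eplus n) (xb n i) (xb n j) =
        4 * cond n (Eplus n) (xb n 0) (xb n (2 ^ n))) ∧
    cond n (Eplus n) (xb n 0) (xb n (2 ^ n)) =
      49 * 25 ^ n / ((5 * 3 ^ n + 16 * 10 ^ n) * (3 ^ n + 6 * 10 ^ n)) := by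
  obtain ⟨m, rfl⟩ : ∃ m, n = m + 1 := ⟨n - 1, by omega⟩
  simp only [Nat.add_sub_cancel]
  have e : 2 ^ (m + 1) = 2 ^ m + 2 ^ m := by ring
  have hp : 0 < 2 ^ m := by positivity
  rw [e]
  have hb := cond_succ m 0 (2 ^ m) hp hp
  rw [LL_zero, LL_last] at hb
  refine ⟨?_, ?_, ?_, ?_⟩
  · intro j h1 h2
    obtain ⟨k, rfl⟩ := Nat.exists_eq_add_of_lt h1
    rw [add_assoc, cond_succ m 0 (k + 1) hp (by omega), hb, LL_zero,
      LL_mid m (k + 1) (by omega) (by omega)]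
    ring
  · intro j h1 h2
    rw [cond_succ m j (2 ^ m) h2 hp, hb, LL_last, LL_mid m j h1 h2]
    ring
  · intro i j h1 h2 h3 h4
    obtain ⟨k, rfl⟩ := Nat.exists_eq_add_of_lt h3
    rw [add_assoc, cond_succ m i (k + 1) h2 (by omega), hb, LL_mid m i h1 h2,
      LL_mid m (k + 1) (by omega) (by omega)]
    ring
  · rw [hb, b_eq]

end SGPaper
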